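/- The function M(φ) = (2/μ²)(1+φ)∫₀^{φ/(1+φ)} ((1−v)/v)^κ e^{κ/v} ∫₀^v u^{κ−1}/(1−u)^{κ+2} e^{−κ/u} du dv satisfies λ(1+φ) M'(φ) + (μ²/2) φ² M''(φ) − λ M(φ) = φ for all φ ∈ (0,∞). -/

import Mathlib

open Real Set intervalIntegral

namespace ResolventODE

open MeasureTheory Topology

/-- The integrand of the inner integral. -/
noncomputable def density (κ u : ℝ) : ℝ :=
  u ^ (κ - 1) * (1 - u) ^ (-(κ + 2)) * Real.exp (-κ / u)

/-- The factor multiplying the inner integral. -/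
noncomputable def weight (κ v : ℝ) : ℝ :=
  ((1 - v) / v) ^ κ * Real.exp (κ / v)

/-- The integrand of the outer integral. -/
noncomputable def outer (κ v : ℝ) : ℝ :=
  weight κ v * ∫ u in (0:ℝ)..v, density κ u

lemma measurable_density (κ : ℝ) : Measurable (density κ) := by
  unfold density
  fun_prop

lemma density_nonneg {κ u : ℝ} (h0 : 0 ≤ u) (h1 : u ≤ 1) : 0 ≤ density κ u := by
  have : 0 ≤ 1 - u := by linarith
  unfold density
  positivity

lemma weight_nonneg {κ v : ℝ} (h0 : 0 ≤ v) (h1 : v ≤ 1) : 0 ≤ weight κ v := by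
  have : 0 ≤ 1 - v := by linarith
  unfold weight
  positivity

lemma density_le {κ u v : ℝ} (hκ : 0 < κ) (h0 : 0 < u) (huv : u ≤ v) (h1 : v < 1) :
    density κ u ≤ (1 - v) ^ (-(κ + 2)) * Real.exp (-κ / v) * u ^ (κ - 1) := by
  have hv : 0 < 1 - v := by linarith
  have hu : 0 < 1 - u := by linarith
  have hpow : (1 - u) ^ (-(κ + 2)) ≤ (1 - v) ^ (-(κ + 2)) :=
    Real.rpow_le_rpow_of_nonpos hv (by linarith) (by linarith)
  have hexp : Real.exp (-κ / u) ≤ Real.exp (-κ / v) := by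
    rw [Real.exp_le_exp, neg_div, neg_div, neg_le_neg_iff]
    exact div_le_div_of_nonneg_left hκ.le h0 huv
  calc density κ u
      = u ^ (κ - 1) * ((1 - u) ^ (-(κ + 2)) * Real.exp (-κ / u)) := by
        unfold density; ring
    _ ≤ u ^ (κ - 1) * ((1 - v) ^ (-(κ + 2)) * Real.exp (-κ / v)) := by gcongr
    _ = _ := by ring

lemma intervalIntegrable_density {κ v : ℝ} (hκ : 0 < κ) (h0 : 0 < v) (h1 : v < 1) :
    IntervalIntegrable (density κ) volume 0 v := by
  have hdom : IntervalIntegrable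
      (fun u : ℝ => (1 - v) ^ (-(κ + 2)) * Real.exp (-κ / v) * u ^ (κ - 1)) volume 0 v :=
    (intervalIntegrable_rpow' (by linarith)).const_mul _
  refine hdom.mono_fun (measurable_density κ).aestronglyMeasurable ?_
  filter_upwards [ae_restrict_mem measurableSet_uIoc] with u hu
  rw [uIoc_of_le h0.le] at hu
  rw [Real.norm_of_nonneg (density_nonneg hu.1.le (hu.2.trans h1.le))]
  exact (density_le hκ hu.1 hu.2 h1).trans (le_abs_self _)

lemma integral_density_nonneg {κ v : ℝ} (h0 : 0 ≤ v) (h1 : v ≤ 1) :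
    0 ≤ ∫ u in (0:ℝ)..v, density κ u :=
  integral_nonneg h0 fun _ hu => density_nonneg hu.1 (hu.2.trans h1)

lemma integral_density_le {κ v : ℝ} (hκ : 0 < κ) (h0 : 0 < v) (h1 : v < 1) :
    ∫ u in (0:ℝ)..v, density κ u ≤
      (1 - v) ^ (-(κ + 2)) * Real.exp (-κ / v) * (v ^ κ / κ) := by
  have hpow : ∫ u in (0:ℝ)..v, u ^ (κ - 1) = v ^ κ / κ := by
    rw [integral_rpow (Or.inl (by linarith)), sub_add_cancel, Real.zero_rpow hκ.ne', sub_zero]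
  rw [← hpow, ← intervalIntegral.integral_const_mul]
  refine integral_mono_on_of_le_Ioo h0.le (intervalIntegrable_density hκ h0 h1)
    ((intervalIntegrable_rpow' (by linarith)).const_mul _) fun u hu => ?_
  exact density_le hκ hu.1 hu.2.le h1

lemma weight_mul_density {κ v : ℝ} (h0 : 0 < v) (h1 : v < 1) :
    weight κ v * density κ v = (v * (1 - v) ^ 2)⁻¹ := by
  have hv : 0 < 1 - v := by linarith
  unfold weight density
  rw [Real.div_rpow hv.le h0.le, Real.rpow_sub_one h0.ne', Real.rpow_neg hv.le,
    Real.rpow_add hv, Real.rpow_two, neg_div, Real.exp_neg]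
  have := (Real.rpow_pos_of_pos hv κ).ne'
  have := (Real.rpow_pos_of_pos h0 κ).ne'
  field_simp

lemma outer_le {κ v : ℝ} (hκ : 0 < κ) (h0 : 0 < v) (h1 : v < 1) :
    outer κ v ≤ ((1 - v) ^ 2)⁻¹ / κ := by
  calc outer κ v
      ≤ weight κ v * ((1 - v) ^ (-(κ + 2)) * Real.exp (-κ / v) * (v ^ κ / κ)) :=
        mul_le_mul_of_nonneg_left (integral_density_le hκ h0 h1) (weight_nonneg h0.le h1.le)
    _ = weight κ v * density κ v * v / κ := by
        unfold density
        rw [Real.rpow_sub_one h0.ne']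
        field_simp
    _ = ((1 - v) ^ 2)⁻¹ / κ := by
        rw [weight_mul_density h0 h1]
        field_simp

lemma hasDerivAt_weight {κ v : ℝ} (h0 : 0 < v) (h1 : v < 1) :
    HasDerivAt (weight κ) (-(κ / (v ^ 2 * (1 - v))) * weight κ v) v := by
  have hv : 0 < 1 - v := by linarith
  have hq : 0 < (1 - v) / v := div_pos hv h0
  have hquot : HasDerivAt (fun v : ℝ => (1 - v) / v) (-(1 / v ^ 2)) v := by
    refine (((hasDerivAt_id' v).const_sub 1).div (hasDerivAt_id' v) h0.ne').congr_deriv ?_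
    field_simp
    ring
  have hexp : HasDerivAt (fun v : ℝ => Real.exp (κ / v))
      (Real.exp (κ / v) * (-(κ / v ^ 2))) v := by
    refine ((hasDerivAt_const v κ).div (hasDerivAt_id' v) h0.ne').exp.congr_deriv ?_
    simp [neg_div]
  refine ((hquot.rpow_const (p := κ) (Or.inl hq.ne')).mul hexp).congr_deriv ?_
  rw [Real.rpow_sub_one hq.ne']
  unfold weight
  field_simp
  ring

lemma hasDerivAt_integral_density {κ v : ℝ} (hκ : 0 < κ) (h0 : 0 < v) (h1 : v < 1) :
    HasDerivAt (fun v => ∫ u in (0:ℝ)..v, density κ u) (density κ v) v := by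
  refine integral_hasDerivAt_right (intervalIntegrable_density hκ h0 h1)
    (measurable_density κ).stronglyMeasurable.stronglyMeasurableAtFilter ?_
  have hv : 1 - v ≠ 0 := by linarith
  unfold density
  exact ((continuousAt_id.rpow_const (Or.inl h0.ne')).mul
    ((continuousAt_const.sub continuousAt_id).rpow_const (Or.inl hv))).mul
    (continuousAt_const.div continuousAt_id h0.ne').rexp

lemma hasDerivAt_outer {κ v : ℝ} (hκ : 0 < κ) (h0 : 0 < v) (h1 : v < 1) :
    HasDerivAt (outer κ)
      ((v * (1 - v) ^ 2)⁻¹ - κ / (v ^ 2 * (1 - v)) * outer κ v) v := by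
  refine ((hasDerivAt_weight (κ := κ) h0 h1).mul
    (hasDerivAt_integral_density hκ h0 h1)).congr_deriv ?_
  rw [weight_mul_density h0 h1]
  unfold outer
  ring

lemma continuousOn_outer {κ : ℝ} (hκ : 0 < κ) : ContinuousOn (outer κ) (Ioo 0 1) :=
  fun _ hv => (hasDerivAt_outer hκ hv.1 hv.2).continuousAt.continuousWithinAt

lemma intervalIntegrable_outer {κ v : ℝ} (hκ : 0 < κ) (h0 : 0 < v) (h1 : v < 1) :
    IntervalIntegrable (outer κ) volume 0 v := by
  have hmeas : AEStronglyMeasurable (outer κ) (volume.restrict (uIoc 0 v)) := by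
    rw [uIoc_of_le h0.le]
    exact ((continuousOn_outer hκ).mono fun u hu =>
      ⟨hu.1, hu.2.trans_lt h1⟩).aestronglyMeasurable measurableSet_Ioc
  refine (intervalIntegrable_const (c := ((1 - v) ^ 2)⁻¹ / κ)).mono_fun hmeas ?_
  filter_upwards [ae_restrict_mem measurableSet_uIoc] with u hu
  rw [uIoc_of_le h0.le] at hu
  have hu1 : u < 1 := hu.2.trans_lt h1
  have hnonneg : 0 ≤ outer κ u :=
    mul_nonneg (weight_nonneg hu.1.le hu1.le) (integral_density_nonneg hu.1.le hu1.le)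
  rw [Real.norm_of_nonneg hnonneg]
  refine (outer_le hκ hu.1 hu1).trans (le_trans ?_ (le_abs_self _))
  have hv : 0 < 1 - v := by linarith
  have huv : 1 - v ≤ 1 - u := by linarith [hu.2]
  gcongr

lemma hasDerivAt_integral_outer {κ v : ℝ} (hκ : 0 < κ) (h0 : 0 < v) (h1 : v < 1) :
    HasDerivAt (fun x => ∫ v in (0:ℝ)..x, outer κ v) (outer κ v) v :=
  integral_hasDerivAt_right (intervalIntegrable_outer hκ h0 h1)
    ((continuousOn_outer hκ).stronglyMeasurableAtFilter isOpen_Ioo v ⟨h0, h1⟩)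
    (hasDerivAt_outer hκ h0 h1).continuousAt

lemma hasDerivAt_div_one_add {φ : ℝ} (h : 0 < φ) :
    HasDerivAt (fun φ : ℝ => φ / (1 + φ)) (1 / (1 + φ) ^ 2) φ := by
  have hφ : 1 + φ ≠ 0 := by linarith
  refine ((hasDerivAt_id' φ).div ((hasDerivAt_id' φ).const_add 1) hφ).congr_deriv ?_
  simp

end ResolventODE

open ResolventODE in
/-- the function `M` from (4.9) solves the one-dimensional
resolvent equation `λ(1+φ) M' + (μ²/2) φ² M'' − λ M = φ` on `(0,∞)`. -/
theorem stmt7 (lam μ : ℝ) (hlam : 0 < lam) (hμ : μ ≠ 0)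
    (κ : ℝ) (hκ : κ = 2 * lam / μ ^ 2)
    (M : ℝ → ℝ)
    (hM : ∀ φ : ℝ, M φ =
      2 / μ ^ 2 * (1 + φ) * ∫ v in (0:ℝ)..(φ / (1 + φ)),
        ((1 - v) / v) ^ κ * Real.exp (κ / v) *
          ∫ u in (0:ℝ)..v, u ^ (κ - 1) * (1 - u) ^ (-(κ + 2)) * Real.exp (-κ / u)) :
    ∀ φ ∈ Set.Ioi (0:ℝ),
      lam * (1 + φ) * deriv M φ + μ ^ 2 / 2 * φ ^ 2 * deriv (deriv M) φ
        - lam * M φ = φ := by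
  have hκ0 : 0 < κ := by rw [hκ]; positivity
  have hMeq : M = fun φ => 2 / μ ^ 2 * (1 + φ) * ∫ v in (0:ℝ)..(φ / (1 + φ)), outer κ v :=
    funext hM
  have hunit : ∀ φ : ℝ, 0 < φ → 0 < φ / (1 + φ) ∧ φ / (1 + φ) < 1 := fun φ h =>
    ⟨by positivity, by rw [div_lt_one (by linarith)]; linarith⟩
  have hasDeriv_integral : ∀ φ : ℝ, 0 < φ → HasDerivAt (fun φ => ∫ v in (0:ℝ)..(φ / (1 + φ)), outer κ v)
      (outer κ (φ / (1 + φ)) * (1 / (1 + φ) ^ 2)) φ := fun φ h =>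
    HasDerivAt.comp (h₂ := fun x => ∫ v in (0:ℝ)..x, outer κ v) φ
      (hasDerivAt_integral_outer hκ0 (hunit φ h).1 (hunit φ h).2) (hasDerivAt_div_one_add h)
  have hM' : ∀ φ : ℝ, 0 < φ → HasDerivAt M (2 / μ ^ 2 *
      ((∫ v in (0:ℝ)..(φ / (1 + φ)), outer κ v) + outer κ (φ / (1 + φ)) / (1 + φ))) φ := by
    intro φ h
    rw [hMeq]
    refine ((((hasDerivAt_id' φ).const_add 1).const_mul (2 / μ ^ 2)).mul
      (hasDeriv_integral φ h)).congr_deriv ?_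
    field_simp
  intro φ h
  replace h : 0 < φ := h
  obtain ⟨h0, h1⟩ := hunit φ h
  have hφ : 1 + φ ≠ 0 := by linarith
  have hM'' := (((hasDeriv_integral φ h).add (((hasDerivAt_outer hκ0 h0 h1).comp φ
    (hasDerivAt_div_one_add h)).div ((hasDerivAt_id' φ).const_add 1) hφ)).const_mul (2 / μ ^ 2))
  have hderiv := (hM''.congr_of_eventuallyEq ((eventually_gt_nhds h).mono
    fun y hy => (hM' y hy).deriv)).deriv
  have hsub : 1 - φ / (1 + φ) = 1 / (1 + φ) := by field_simp; ring
  rw [hderiv, (hM' φ h).deriv, hMeq]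
  simp only [Function.comp_apply, hsub]
  generalize outer κ (φ / (1 + φ)) = g
  generalize (∫ v in (0:ℝ)..(φ / (1 + φ)), outer κ v) = I
  rw [hκ]
  field_simp
  ring
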